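/- arXiv:1309.2473 — 7 statements merged into one kernel-verified Lean document; each statement's English description precedes it below -/
import Mathlib

section
/- Let S₁,…,S₆ ⊂ ℂ be finite constellations, each with nonzero Coordinate Product Distance. Then there exists θ ∈ [0, 2π] such that for every pair of tuples x = (x¹,…,x⁶) and y = (y¹,…,y⁶) with xᵏ, yᵏ ∈ Sₖ for all k and x ≠ y, the 3×4 difference matrix X'(θ; x) − X'(θ; y) has rank 3. -/
open Complex Matrix

/-- The proposed 3×4 STBC `X'(θ; x¹,…,x⁶)` for three transmit antennas.
Symbols are indexed `x 0, …, x 5` corresponding to `x¹, …, x⁶`. -/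
noncomputable def Xc (θ : ℝ) (x : Fin 6 → ℂ) : Matrix (Fin 3) (Fin 4) ℂ :=
  ![![((x 0).re : ℂ) + ((x 2).im : ℂ) * I,
     -((x 1).re : ℂ) + ((x 3).im : ℂ) * I,
     exp (θ * I) * (((x 4).re : ℂ) + ((x 5).im : ℂ) * I),
     exp (θ * I) * (-((x 2).re : ℂ) + ((x 0).im : ℂ) * I)],
    ![((x 1).re : ℂ) + ((x 3).im : ℂ) * I,
     ((x 0).re : ℂ) - ((x 2).im : ℂ) * I,
     exp (θ * I) * (((x 3).re : ℂ) + ((x 1).im : ℂ) * I),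
     exp (θ * I) * (((x 4).re : ℂ) - ((x 5).im : ℂ) * I)],
    ![exp (θ * I) * (((x 5).re : ℂ) + ((x 4).im : ℂ) * I),
     exp (θ * I) * (-((x 5).re : ℂ) + ((x 4).im : ℂ) * I),
     ((x 2).re : ℂ) + ((x 0).im : ℂ) * I,
     -((x 3).re : ℂ) + ((x 1).im : ℂ) * I]]

/-- A finite constellation `S ⊆ ℂ` has nonzero Coordinate Product Distance. -/
def HasNonzeroCPD (S : Set ℂ) : Prop :=
  ∀ u ∈ S, ∀ v ∈ S, u ≠ v → (u.re - v.re) * (u.im - v.im) ≠ 0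

theorem rank_of_minor (M : Matrix (Fin 3) (Fin 4) ℂ) (f : Fin 3 → Fin 4)
    (h : (M.submatrix id f).det ≠ 0) : M.rank = 3 := by
  apply le_antisymm
  · simpa using M.rank_le_height
  · have h1 : (M.submatrix id f).rank = 3 := by
      have := Matrix.rank_of_isUnit (M.submatrix id f)
        ((Matrix.isUnit_iff_isUnit_det _).2 (isUnit_iff_ne_zero.2 h))
      simpa using this
    have h2 : M.submatrix id f = M * (1 : Matrix (Fin 4) (Fin 4) ℂ).submatrix id f := by
      ext i j
      simp [Matrix.mul_apply, Matrix.one_apply]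
    have h3 : (M.submatrix id f).rank ≤ M.rank := by
      rw [h2]
      exact Matrix.rank_mul_le_left _ _
    omega

theorem Xc_sub (θ : ℝ) (x y : Fin 6 → ℂ) : Xc θ x - Xc θ y = Xc θ (x - y) := by
  ext i j
  rw [Matrix.sub_apply]
  fin_cases i <;> fin_cases j <;> simp [Xc] <;> ring

theorem ne_of_re (z : ℂ) (a b : ℝ) (hz : z = a + b * I) (ha : a ≠ 0) : z ≠ 0 := by
  rintro rfl
  apply ha
  simpa using (congrArg Complex.re hz).symm

theorem ne_of_im (z : ℂ) (a b : ℝ) (hz : z = a + b * I) (hb : b ≠ 0) : z ≠ 0 := by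
  rintro rfl
  apply hb
  simpa using (congrArg Complex.im hz).symm

theorem aff_ne (c B s : ℂ) (hc : c ≠ 0) (hs : s ≠ -c / B) : c + s * B ≠ 0 := by
  intro h
  by_cases hB : B = 0
  · simp [hB] at h; exact hc h
  · apply hs
    rw [eq_div_iff hB]
    linear_combination h

theorem aff_ex (c B : ℂ) (hc : c ≠ 0) : ∃ s0 : ℂ, ∀ s, s ≠ s0 → c + s * B ≠ 0 :=
  ⟨-c / B, fun s hs => aff_ne c B s hc hs⟩

theorem exists_bad (d : Fin 6 → ℂ) (hd : ∀ k, d k ≠ 0 → (d k).re ≠ 0 ∧ (d k).im ≠ 0)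
    (h0 : d ≠ 0) :
    ∃ s : ℂ, ∀ θ : ℝ, exp (θ * I) ^ 2 ≠ s → (Xc θ d).rank = 3 := by
  have hpos : (∃ k : Fin 4, d (Fin.castLE (by omega) k) ≠ 0) →
      ((((d 0).re ^ 2 + (d 2).im ^ 2 + (d 1).re ^ 2 + (d 3).im ^ 2 : ℝ)) : ℂ) ≠ 0 := by
    rintro ⟨k, hk⟩
    obtain ⟨h1, h2⟩ := hd _ hk
    rw [Complex.ofReal_ne_zero]
    apply ne_of_gt
    fin_cases k <;> simp at h1 h2 <;> positivity
  by_cases hA : d 0 ≠ 0 ∨ d 2 ≠ 0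
  · have hc : (((d 2).re : ℂ) + ((d 0).im : ℂ) * I) ≠ 0 := by
      rcases hA with h | h
      · exact ne_of_im _ _ _ rfl (hd _ h).2
      · exact ne_of_re _ _ _ rfl (hd _ h).1
    have hP := hpos (by
      rcases hA with h | h
      · exact ⟨0, h⟩
      · exact ⟨2, h⟩)
    obtain ⟨s, key⟩ := aff_ex _ ((((d 5).re : ℂ) + ((d 4).im : ℂ) * I) *
          ((-((d 1).re : ℂ) + ((d 3).im : ℂ) * I) * (((d 3).re : ℂ) + ((d 1).im : ℂ) * I)
            - (((d 4).re : ℂ) + ((d 5).im : ℂ) * I) * (((d 0).re : ℂ) - ((d 2).im : ℂ) * I))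
          - (-((d 5).re : ℂ) + ((d 4).im : ℂ) * I) *
          ((((d 0).re : ℂ) + ((d 2).im : ℂ) * I) * (((d 3).re : ℂ) + ((d 1).im : ℂ) * I)
            - (((d 4).re : ℂ) + ((d 5).im : ℂ) * I) * (((d 1).re : ℂ) + ((d 3).im : ℂ) * I)))
          (mul_ne_zero hP hc)
    refine ⟨s, fun θ hθ => rank_of_minor _ ![0, 1, 2] ?_⟩
    · replace key := key _ hθ
      convert key using 1
      simp only [Matrix.det_fin_three, Matrix.submatrix_apply]
      simp [Xc]
      linear_combination (-(((d 2).re : ℂ) + ((d 0).im : ℂ) * I) *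
        (((d 2).im : ℂ) ^ 2 + ((d 3).im : ℂ) ^ 2)) * Complex.I_sq
  by_cases hB : d 1 ≠ 0 ∨ d 3 ≠ 0
  · have hc : (-((d 3).re : ℂ) + ((d 1).im : ℂ) * I) ≠ 0 := by
      rcases hB with h | h
      · exact ne_of_im _ (-(d 3).re) _ (by push_cast; rfl) (hd _ h).2
      · exact ne_of_re _ (-(d 3).re) (d 1).im (by push_cast; rfl) (neg_ne_zero.2 (hd _ h).1)
    have hP := hpos (by
      rcases hB with h | h
      · exact ⟨1, h⟩
      · exact ⟨3, h⟩)
    obtain ⟨s, key⟩ := aff_ex _ ((((d 5).re : ℂ) + ((d 4).im : ℂ) * I) *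
          ((-((d 1).re : ℂ) + ((d 3).im : ℂ) * I) * (((d 4).re : ℂ) - ((d 5).im : ℂ) * I)
            - (-((d 2).re : ℂ) + ((d 0).im : ℂ) * I) * (((d 0).re : ℂ) - ((d 2).im : ℂ) * I))
          - (-((d 5).re : ℂ) + ((d 4).im : ℂ) * I) *
          ((((d 0).re : ℂ) + ((d 2).im : ℂ) * I) * (((d 4).re : ℂ) - ((d 5).im : ℂ) * I)
            - (-((d 2).re : ℂ) + ((d 0).im : ℂ) * I) * (((d 1).re : ℂ) + ((d 3).im : ℂ) * I)))
          (mul_ne_zero hP hc)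
    refine ⟨s, fun θ hθ => rank_of_minor _ ![0, 1, 3] ?_⟩
    · replace key := key _ hθ
      convert key using 1
      simp only [Matrix.det_fin_three, Matrix.submatrix_apply]
      simp [Xc]
      linear_combination (-(-((d 3).re : ℂ) + ((d 1).im : ℂ) * I) *
        (((d 2).im : ℂ) ^ 2 + ((d 3).im : ℂ) ^ 2)) * Complex.I_sq
  push Not at hA hB
  obtain ⟨e0, e2⟩ := hA
  obtain ⟨e1, e3⟩ := hB
  have hC : d 4 ≠ 0 ∨ d 5 ≠ 0 := by
    by_contra! h
    apply h0
    ext k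
    fin_cases k <;> simp [*]
  refine ⟨0, fun θ _ => rank_of_minor _ ![0, 2, 3] ?_⟩
  have h1 : ((d 5).re : ℂ) + ((d 4).im : ℂ) * I ≠ 0 := by
    rcases hC with h | h
    · exact ne_of_im _ _ _ rfl (hd _ h).2
    · exact ne_of_re _ _ _ rfl (hd _ h).1
  have h2 : ((d 4).re : ℂ) + ((d 5).im : ℂ) * I ≠ 0 := by
    rcases hC with h | h
    · exact ne_of_re _ _ _ rfl (hd _ h).1
    · exact ne_of_im _ _ _ rfl (hd _ h).2
  have h3 : ((d 4).re : ℂ) - ((d 5).im : ℂ) * I ≠ 0 := by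
    rcases hC with h | h
    · exact ne_of_re _ (d 4).re (-(d 5).im) (by push_cast; ring) (hd _ h).1
    · exact ne_of_im _ (d 4).re (-(d 5).im) (by push_cast; ring) (neg_ne_zero.2 (hd _ h).2)
  simp only [Matrix.det_fin_three, Matrix.submatrix_apply]
  simp [Xc, e0, e1, e2, e3, h1, h2, h3, Complex.exp_ne_zero]

theorem exists_theta_avoid (F : Set ℂ) (hF : F.Finite) :
    ∃ θ ∈ Set.Icc (0 : ℝ) (2 * Real.pi), exp (θ * I) ^ 2 ∉ F := by
  have hinj : Set.InjOn (fun θ : ℝ => exp (θ * I) ^ 2) (Set.Icc 0 1) := by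
    intro a ha b hb hab
    simp only [← Complex.exp_nat_mul] at hab
    have hpi := Real.pi_gt_three
    have := Complex.exp_inj_of_neg_pi_lt_of_le_pi (x := ((2 : ℕ) : ℂ) * (a * I))
      (y := ((2 : ℕ) : ℂ) * (b * I)) (by simp; linarith [ha.1]) (by simp; linarith [ha.2])
      (by simp; linarith [hb.1]) (by simp; linarith [hb.2]) hab
    have h2 := congrArg Complex.im this
    simpa using h2
  have hinf := (Set.Icc_infinite (zero_lt_one' ℝ)).image hinj
  obtain ⟨s, ⟨θ, hθ, rfl⟩, hs⟩ := (hinf.sdiff hF).nonempty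
  exact ⟨θ, ⟨hθ.1, by linarith [hθ.2, Real.pi_gt_three]⟩, hs⟩

/-- There exists `θ ∈ [0, 2π]` such that every difference matrix of the proposed
STBC over constellations with nonzero CPD has rank 3. -/
theorem exists_theta_rank_three (S : Fin 6 → Set ℂ)
    (hfin : ∀ k, (S k).Finite) (hcpd : ∀ k, HasNonzeroCPD (S k)) :
    ∃ θ ∈ Set.Icc (0 : ℝ) (2 * Real.pi),
      ∀ x y : Fin 6 → ℂ, (∀ k, x k ∈ S k) → (∀ k, y k ∈ S k) → x ≠ y →
        (Xc θ x - Xc θ y).rank = 3 := by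
  let D : Set (Fin 6 → ℂ) := Set.pi Set.univ S
  have hD : D.Finite := Set.Finite.pi' hfin |>.subset (fun x hx k => hx k trivial)
  have H : ∀ p : (Fin 6 → ℂ) × (Fin 6 → ℂ), ∃ s : ℂ, p ∈ D ×ˢ D → p.1 ≠ p.2 →
      ∀ θ : ℝ, exp (θ * I) ^ 2 ≠ s → (Xc θ p.1 - Xc θ p.2).rank = 3 := by
    rintro ⟨x, y⟩
    by_cases h : (x, y) ∈ D ×ˢ D ∧ x ≠ y
    · obtain ⟨⟨hx, hy⟩, hxy⟩ := h
      obtain ⟨s, hs⟩ := exists_bad (x - y) (fun k hk => by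
        have := hcpd k (x k) (hx k trivial) (y k) (hy k trivial) (sub_ne_zero.1 hk)
        simpa using mul_ne_zero_iff.1 this) (sub_ne_zero.2 hxy)
      exact ⟨s, fun _ _ θ hθ => by rw [Xc_sub]; exact hs θ hθ⟩
    · exact ⟨0, fun h1 h2 => absurd ⟨h1, h2⟩ h⟩
  choose g hg using H
  obtain ⟨θ, hθ, hav⟩ := exists_theta_avoid (Set.image g (D ×ˢ D)) ((hD.prod hD).image g)
  refine ⟨θ, hθ, fun x y hx hy hxy => ?_⟩
  have hm : (x, y) ∈ D ×ˢ D := ⟨fun k _ => hx k, fun k _ => hy k⟩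
  exact hg (x, y) hm hxy θ (fun h => hav (h ▸ ⟨_, hm, rfl⟩))
end

section
/- Let Δ¹,…,Δ⁶ ∈ ℂ be such that not all Δᵏ are zero and each Δᵏ is either 0 or has both its real part and its imaginary part nonzero. Then the set of θ ∈ [0, 2π] for which the 3×4 matrix X'(θ; Δ¹,…,Δ⁶) has rank strictly less than 3 is finite. -/
open Complex Matrix

theorem minor_zero (X : Matrix (Fin 3) (Fin 4) ℂ) (c : Fin 3 → Fin 4) (h : X.rank < 3) :
    (X.submatrix id c).det = 0 := by
  by_contra hd
  have h1 : X.submatrix id c = X * (1 : Matrix (Fin 4) (Fin 4) ℂ).submatrix id c := by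
    ext i j
    simp [Matrix.mul_apply, Matrix.one_apply]
  have h2 := Matrix.rank_of_isUnit (X.submatrix id c)
    ((Matrix.isUnit_iff_isUnit_det _).2 (isUnit_iff_ne_zero.2 hd))
  have h3 := Matrix.rank_mul_le_left X ((1 : Matrix (Fin 4) (Fin 4) ℂ).submatrix id c)
  rw [← h1, h2] at h3
  simp at h3
  omega

theorem finite_aux (A B : ℂ) (hA : A ≠ 0) :
    {θ ∈ Set.Icc (0 : ℝ) (2 * Real.pi) | A + exp (θ * I) ^ 2 * B = 0}.Finite := by
  rcases Set.eq_empty_or_nonempty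
    {θ ∈ Set.Icc (0 : ℝ) (2 * Real.pi) | A + exp (θ * I) ^ 2 * B = 0} with h | ⟨t, ht, hB⟩
  · rw [h]
    exact Set.finite_empty
  · refine ((Set.finite_Icc (-2 : ℤ) 2).image (fun n : ℤ => t + n * Real.pi)).subset ?_
    rintro s ⟨hs, hsB⟩
    have hB0 : B ≠ 0 := by
      rintro rfl
      apply hA
      simpa using hB
    have he : exp (s * I) ^ 2 = exp (t * I) ^ 2 :=
      mul_right_cancel₀ hB0 (by linear_combination hsB - hB)
    rw [← Complex.exp_nat_mul, ← Complex.exp_nat_mul, Complex.exp_eq_exp_iff_exists_int] at he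
    obtain ⟨n, hn⟩ := he
    have hn' : s = t + n * Real.pi := by
      have := congrArg Complex.im hn
      simp at this
      linarith
    have hpi := Real.pi_pos
    refine ⟨n, ⟨?_, ?_⟩, hn'.symm⟩
    · have : (-2 : ℝ) ≤ n := by
        by_contra hc
        push Not at hc
        have := hs.1
        have := ht.2
        nlinarith
      exact_mod_cast this
    · have : (n : ℝ) ≤ 2 := by
        by_contra hc
        push Not at hc
        have := hs.2
        have := ht.1
        nlinarith
      exact_mod_cast this

/-- If the symbol differences `Δᵏ` are not all zero and each is zero or has both
real and imaginary parts nonzero, then only finitely many `θ ∈ [0, 2π]` give a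
difference matrix of rank less than 3. -/
theorem finite_bad_theta (Δ : Fin 6 → ℂ)
    (hne : ∃ k, Δ k ≠ 0)
    (hcpd : ∀ k, Δ k = 0 ∨ ((Δ k).re ≠ 0 ∧ (Δ k).im ≠ 0)) :
    {θ ∈ Set.Icc (0 : ℝ) (2 * Real.pi) | (Xc θ Δ).rank < 3}.Finite := by
  by_cases h4 : Δ 0 = 0 ∧ Δ 1 = 0 ∧ Δ 2 = 0 ∧ Δ 3 = 0
  · obtain ⟨h0, h1, h2, h3⟩ := h4
    convert Set.finite_empty (α := ℝ)
    ext θ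
    simp only [Set.mem_ofPred_eq, Set.mem_empty_iff_false, iff_false]
    rintro ⟨-, hr⟩
    have hd := minor_zero _ ![0, 2, 3] hr
    have hE := Complex.exp_ne_zero (θ * I)
    simp only [Matrix.det_fin_three, Matrix.submatrix_apply] at hd
    simp [Xc, h0, h1, h2, h3, hE] at hd
    have e1 := hcpd 4
    have e2 := hcpd 5
    have e3 : Δ 4 ≠ 0 ∨ Δ 5 ≠ 0 := by
      obtain ⟨k, hk⟩ := hne
      fin_cases k <;> simp_all
    simp [Complex.ext_iff] at hd e1 e2 e3
    grind
  · set N : ℝ := (Δ 0).re ^ 2 + (Δ 2).im ^ 2 + (Δ 1).re ^ 2 + (Δ 3).im ^ 2 with hN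
    have hN0 : N ≠ 0 := by
      intro hz
      have a0 : (Δ 0).re = 0 := by nlinarith [sq_nonneg (Δ 0).re, sq_nonneg (Δ 2).im, sq_nonneg (Δ 1).re, sq_nonneg (Δ 3).im]
      have a1 : (Δ 2).im = 0 := by nlinarith [sq_nonneg (Δ 0).re, sq_nonneg (Δ 2).im, sq_nonneg (Δ 1).re, sq_nonneg (Δ 3).im]
      have a2 : (Δ 1).re = 0 := by nlinarith [sq_nonneg (Δ 0).re, sq_nonneg (Δ 2).im, sq_nonneg (Δ 1).re, sq_nonneg (Δ 3).im]
      have a3 : (Δ 3).im = 0 := by nlinarith [sq_nonneg (Δ 0).re, sq_nonneg (Δ 2).im, sq_nonneg (Δ 1).re, sq_nonneg (Δ 3).im]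
      have := hcpd 0
      have := hcpd 1
      have := hcpd 2
      have := hcpd 3
      tauto
    have hNc : (N : ℂ) ≠ 0 := by exact_mod_cast hN0
    have hI : I ^ 2 = -1 := Complex.I_sq
    by_cases hs : ((Δ 2).re : ℂ) + ((Δ 0).im : ℂ) * I = 0
    · have ht : -((Δ 3).re : ℂ) + ((Δ 1).im : ℂ) * I ≠ 0 := by
        intro ht
        simp [Complex.ext_iff] at hs ht
        have := hcpd 0
        have := hcpd 1
        have := hcpd 2
        have := hcpd 3
        tauto
      refine (finite_aux _
        ((((Δ 5).re : ℂ) + ((Δ 4).im : ℂ) * I) *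
          ((-((Δ 1).re : ℂ) + ((Δ 3).im : ℂ) * I) * (((Δ 4).re : ℂ) - ((Δ 5).im : ℂ) * I)
            - (-((Δ 2).re : ℂ) + ((Δ 0).im : ℂ) * I) * (((Δ 0).re : ℂ) - ((Δ 2).im : ℂ) * I))
        - (-((Δ 5).re : ℂ) + ((Δ 4).im : ℂ) * I) *
          ((((Δ 0).re : ℂ) + ((Δ 2).im : ℂ) * I) * (((Δ 4).re : ℂ) - ((Δ 5).im : ℂ) * I)
            - (-((Δ 2).re : ℂ) + ((Δ 0).im : ℂ) * I) * (((Δ 1).re : ℂ) + ((Δ 3).im : ℂ) * I)))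
        (mul_ne_zero ht hNc)).subset ?_
      rintro θ ⟨hθ, hr⟩
      refine ⟨hθ, ?_⟩
      have hd := minor_zero _ ![0, 1, 3] hr
      simp only [Matrix.det_fin_three, Matrix.submatrix_apply] at hd
      simp [Xc] at hd
      rw [hN]
      push_cast
      linear_combination hd - (-((Δ 3).re : ℂ) + ((Δ 1).im : ℂ) * I) * (-((Δ 2).im : ℂ) ^ 2 - ((Δ 3).im : ℂ) ^ 2) * hI
    · refine (finite_aux _
        ((((Δ 5).re : ℂ) + ((Δ 4).im : ℂ) * I) *
          ((-((Δ 1).re : ℂ) + ((Δ 3).im : ℂ) * I) * (((Δ 3).re : ℂ) + ((Δ 1).im : ℂ) * I)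
            - (((Δ 4).re : ℂ) + ((Δ 5).im : ℂ) * I) * (((Δ 0).re : ℂ) - ((Δ 2).im : ℂ) * I))
        - (-((Δ 5).re : ℂ) + ((Δ 4).im : ℂ) * I) *
          ((((Δ 0).re : ℂ) + ((Δ 2).im : ℂ) * I) * (((Δ 3).re : ℂ) + ((Δ 1).im : ℂ) * I)
            - (((Δ 4).re : ℂ) + ((Δ 5).im : ℂ) * I) * (((Δ 1).re : ℂ) + ((Δ 3).im : ℂ) * I)))
        (mul_ne_zero hs hNc)).subset ?_
      rintro θ ⟨hθ, hr⟩
      refine ⟨hθ, ?_⟩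
      have hd := minor_zero _ ![0, 1, 2] hr
      simp only [Matrix.det_fin_three, Matrix.submatrix_apply] at hd
      simp [Xc] at hd
      rw [hN]
      push_cast
      linear_combination hd - (((Δ 2).re : ℂ) + ((Δ 0).im : ℂ) * I) * (-((Δ 2).im : ℂ) ^ 2 - ((Δ 3).im : ℂ) ^ 2) * hI
end

section
/- Let Δ¹,…,Δ⁶ ∈ ℂ satisfy Δ¹ = Δ³ = Δ⁵ = Δ⁶ = 0, (Δ², Δ⁴) ≠ (0, 0), and each nonzero Δᵏ has both its real part and its imaginary part nonzero. Then for every θ ∈ ℝ, the 3×3 matrix B formed by the last three columns of X'(θ; Δ¹,…,Δ⁶) has determinant e^{iθ}(−Re Δ² + i·Im Δ⁴)(−(Re Δ⁴)² − (Im Δ²)²) ≠ 0, and hence X'(θ; Δ¹,…,Δ⁶) has rank 3. -/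
open Complex Matrix

/-- Case 1 of Lemma 1: if `Δ¹ = Δ³ = Δ⁵ = Δ⁶ = 0` and `(Δ², Δ⁴) ≠ (0,0)`, then
the last three columns of `X'(θ; Δ)` have the stated nonzero determinant, and
`X'(θ; Δ)` has rank 3, for every `θ`. -/
theorem case1_det_B (Δ : Fin 6 → ℂ)
    (h1 : Δ 0 = 0) (h3 : Δ 2 = 0) (h5 : Δ 4 = 0) (h6 : Δ 5 = 0)
    (h24 : ¬(Δ 1 = 0 ∧ Δ 3 = 0))
    (hcpd : ∀ k, Δ k = 0 ∨ ((Δ k).re ≠ 0 ∧ (Δ k).im ≠ 0)) :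
    ∀ θ : ℝ,
      ((Xc θ Δ).submatrix id Fin.succ).det =
        exp (θ * I) * (-((Δ 1).re : ℂ) + ((Δ 3).im : ℂ) * I) *
          (-((Δ 3).re : ℂ) ^ 2 - ((Δ 1).im : ℂ) ^ 2) ∧
      ((Xc θ Δ).submatrix id Fin.succ).det ≠ 0 ∧
      (Xc θ Δ).rank = 3 := by
  intro θ
  have hdet : ((Xc θ Δ).submatrix id Fin.succ).det =
        exp (θ * I) * (-((Δ 1).re : ℂ) + ((Δ 3).im : ℂ) * I) *
          (-((Δ 3).re : ℂ) ^ 2 - ((Δ 1).im : ℂ) ^ 2) := by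
    rw [Matrix.det_fin_three]
    have e0 : Fin.succ (0 : Fin 3) = (1 : Fin 4) := rfl
    have e1 : Fin.succ (1 : Fin 3) = (2 : Fin 4) := rfl
    have e2 : Fin.succ (2 : Fin 3) = (3 : Fin 4) := rfl
    simp only [Matrix.submatrix_apply, id, e0, e1, e2]
    simp [Xc, h1, h3, h5, h6]
    linear_combination exp (θ * I) * (-((Δ 1).re : ℂ) + ((Δ 3).im : ℂ) * I) *
      ((Δ 1).im : ℂ) ^ 2 * Complex.I_sq
  have hne : ((Xc θ Δ).submatrix id Fin.succ).det ≠ 0 := by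
    have hk : ((Δ 1).re ≠ 0 ∧ (Δ 1).im ≠ 0) ∨ ((Δ 3).re ≠ 0 ∧ (Δ 3).im ≠ 0) := by
      rcases hcpd 1 with h | h
      · rcases hcpd 3 with h' | h'
        · exact absurd ⟨h, h'⟩ h24
        · exact Or.inr h'
      · exact Or.inl h
    rw [hdet]
    refine mul_ne_zero (mul_ne_zero (Complex.exp_ne_zero _) ?_) ?_
    · intro h
      have hr := congrArg Complex.re h
      have hi := congrArg Complex.im h
      simp at hr hi
      tauto
    · intro h
      have h' : -(Δ 3).re ^ 2 - (Δ 1).im ^ 2 = 0 := by exact_mod_cast h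
      rcases hk with ⟨_, hb⟩ | ⟨hb, _⟩
      · have := pow_pos (abs_pos.mpr hb) 2
        rw [sq_abs] at this
        nlinarith [sq_nonneg (Δ 3).re]
      · have := pow_pos (abs_pos.mpr hb) 2
        rw [sq_abs] at this
        nlinarith [sq_nonneg (Δ 1).im]
  refine ⟨hdet, hne, le_antisymm ?_ ?_⟩
  · simpa using (Xc θ Δ).rank_le_height
  · have hr : ((Xc θ Δ).submatrix id Fin.succ).rank = 3 := by
      have := Matrix.rank_of_isUnit _
        ((Matrix.isUnit_iff_isUnit_det _).mpr (isUnit_iff_ne_zero.mpr hne))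
      simpa using this
    have hmul : (Xc θ Δ).submatrix id Fin.succ =
        Xc θ Δ * (1 : Matrix (Fin 4) (Fin 4) ℂ).submatrix id Fin.succ := by
      ext i j
      simp [Matrix.mul_apply, Matrix.one_apply]
    rw [hmul] at hr
    refine hr.symm.le.trans ?_
    exact Matrix.rank_mul_le_left _ _
end

section
/- Let Δ¹,…,Δ⁶ ∈ ℂ satisfy (Δ¹, Δ³) ≠ (0, 0), Δ⁵ = Δ⁶ = 0, and each nonzero Δᵏ has both its real part and its imaginary part nonzero. Then for every θ ∈ ℝ, the 3×3 matrix A formed by the first three columns of X'(θ; Δ¹,…,Δ⁶) has determinant (Re Δ³ + i·Im Δ¹)((Re Δ¹)² + (Im Δ³)² + (Re Δ²)² + (Im Δ⁴)²) ≠ 0, and hence X'(θ; Δ¹,…,Δ⁶) has rank 3. -/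
open Complex Matrix

/-- Case 2 of Lemma 1: if `(Δ¹, Δ³) ≠ (0,0)` and `Δ⁵ = Δ⁶ = 0`, then the first
three columns of `X'(θ; Δ)` have the stated nonzero determinant, and `X'(θ; Δ)`
has rank 3, for every `θ`. -/
theorem case2_det_A (Δ : Fin 6 → ℂ)
    (h13 : ¬(Δ 0 = 0 ∧ Δ 2 = 0)) (h5 : Δ 4 = 0) (h6 : Δ 5 = 0)
    (hcpd : ∀ k, Δ k = 0 ∨ ((Δ k).re ≠ 0 ∧ (Δ k).im ≠ 0)) :
    ∀ θ : ℝ,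
      ((Xc θ Δ).submatrix id (Fin.castSucc)).det =
        (((Δ 2).re : ℂ) + ((Δ 0).im : ℂ) * I) *
          (((Δ 0).re : ℂ) ^ 2 + ((Δ 2).im : ℂ) ^ 2 +
           ((Δ 1).re : ℂ) ^ 2 + ((Δ 3).im : ℂ) ^ 2) ∧
      ((Xc θ Δ).submatrix id (Fin.castSucc)).det ≠ 0 ∧
      (Xc θ Δ).rank = 3 := by
  intro θ
  have hdet : ((Xc θ Δ).submatrix id (Fin.castSucc)).det =
        (((Δ 2).re : ℂ) + ((Δ 0).im : ℂ) * I) *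
          (((Δ 0).re : ℂ) ^ 2 + ((Δ 2).im : ℂ) ^ 2 +
           ((Δ 1).re : ℂ) ^ 2 + ((Δ 3).im : ℂ) ^ 2) := by
    have e0 : Fin.castSucc (0 : Fin 3) = (0 : Fin 4) := rfl
    have e1 : Fin.castSucc (1 : Fin 3) = (1 : Fin 4) := rfl
    have e2 : Fin.castSucc (2 : Fin 3) = (2 : Fin 4) := rfl
    rw [Matrix.det_fin_three]
    simp only [Matrix.submatrix_apply, id, e0, e1, e2]
    simp [Xc, h5, h6]
    linear_combination (-(((Δ 2).re : ℂ) + ((Δ 0).im : ℂ) * I) *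
      (((Δ 2).im : ℂ) ^ 2 + ((Δ 3).im : ℂ) ^ 2)) * I_sq
  have hne : ((Xc θ Δ).submatrix id (Fin.castSucc)).det ≠ 0 := by
    rw [hdet]
    apply mul_ne_zero
    · intro h
      have hr := congrArg Complex.re h
      have hi := congrArg Complex.im h
      simp at hr hi
      apply h13
      constructor
      · rcases hcpd 0 with h | h
        · exact h
        · exact absurd hi h.2
      · rcases hcpd 2 with h | h
        · exact h
        · exact absurd hr h.1
    · intro h
      have h' : (Δ 0).re ^ 2 + (Δ 2).im ^ 2 + (Δ 1).re ^ 2 + (Δ 3).im ^ 2 = 0 := by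
        exact_mod_cast h
      have ha : (Δ 0).re = 0 := by
        apply pow_eq_zero_iff (two_ne_zero) |>.1
        nlinarith [sq_nonneg (Δ 0).re, sq_nonneg (Δ 2).im, sq_nonneg (Δ 1).re,
          sq_nonneg (Δ 3).im]
      have hb : (Δ 2).im = 0 := by
        apply pow_eq_zero_iff (two_ne_zero) |>.1
        nlinarith [sq_nonneg (Δ 0).re, sq_nonneg (Δ 2).im, sq_nonneg (Δ 1).re,
          sq_nonneg (Δ 3).im]
      apply h13
      constructor
      · rcases hcpd 0 with h | h
        · exact h
        · exact absurd ha h.1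
      · rcases hcpd 2 with h | h
        · exact h
        · exact absurd hb h.2
  refine ⟨hdet, hne, le_antisymm ?_ ?_⟩
  · simpa using (Xc θ Δ).rank_le_card_height
  · have h1 := Matrix.rank_of_isUnit _
      ((Matrix.isUnit_iff_isUnit_det _).2 (isUnit_iff_ne_zero.2 hne))
    have h2 : (Xc θ Δ).submatrix id Fin.castSucc =
        Xc θ Δ * (1 : Matrix (Fin 4) (Fin 4) ℂ).submatrix id Fin.castSucc := by
      ext i j
      simp [Matrix.mul_apply, Matrix.one_apply]
    have h3 := Matrix.rank_mul_le_left (Xc θ Δ)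
      ((1 : Matrix (Fin 4) (Fin 4) ℂ).submatrix id (Fin.castSucc : Fin 3 → Fin 4))
    rw [← h2, h1] at h3
    simpa using h3
end

section
/- Let Δ¹,…,Δ⁶ ∈ ℂ satisfy (Δ¹, Δ³) ≠ (0, 0), (Δ⁵, Δ⁶) ≠ (0, 0), and each nonzero Δᵏ has both its real part and its imaginary part nonzero. Then there are only finitely many θ ∈ [0, 2π] for which the 3×3 matrix A formed by the first three columns of X'(θ; Δ¹,…,Δ⁶) is singular; consequently X'(θ; Δ¹,…,Δ⁶) has rank 3 for all but finitely many θ ∈ [0, 2π]. -/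
open Complex Matrix

/-- Finitely many angles in `[0, 2π]` have a given value of `exp (θ I)` in a finite set. -/
theorem finite_angles (S : Set ℂ) (hS : S.Finite) :
    {θ ∈ Set.Icc (0 : ℝ) (2 * Real.pi) | exp (θ * I) ∈ S}.Finite := by
  have hinj : Set.InjOn (fun θ : ℝ => exp (θ * I)) (Set.Ico (0 : ℝ) (2 * Real.pi)) := by
    intro a ha b hb hab
    obtain ⟨n, hn⟩ := Complex.exp_eq_exp_iff_exists_int.1 hab
    have h2 : a = b + n * (2 * Real.pi) := by
      have := congrArg Complex.im hn
      simpa using this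
    have hp := Real.pi_pos
    obtain ⟨ha0, ha1⟩ := ha
    obtain ⟨hb0, hb1⟩ := hb
    have h3 : (n : ℝ) < 1 := by
      by_contra hc
      nlinarith
    have h4 : (-1 : ℝ) < n := by
      by_contra hc
      nlinarith
    have h5 : n < 1 := by exact_mod_cast h3
    have h6 : -1 < n := by exact_mod_cast h4
    have h7 : n = 0 := by omega
    simpa [h7] using h2
  have hf : (Set.Ico (0 : ℝ) (2 * Real.pi) ∩ (fun θ : ℝ => exp (θ * I)) ⁻¹' S).Finite := by
    refine Set.Finite.of_finite_image (f := fun θ : ℝ => exp (θ * I)) (hS.subset ?_)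
      (hinj.mono Set.inter_subset_left)
    rintro _ ⟨θ, hθ, rfl⟩
    exact hθ.2
  refine (hf.union (Set.finite_singleton (2 * Real.pi))).subset ?_
  rintro θ ⟨⟨h0, h1⟩, h⟩
  rcases h1.lt_or_eq with h1 | h1
  · exact Or.inl ⟨⟨h0, h1⟩, h⟩
  · exact Or.inr h1

theorem finite_roots (c K : ℂ) (hc : c ≠ 0) : {z : ℂ | c + z ^ 2 * K = 0}.Finite := by
  have hp : (Polynomial.C c + Polynomial.X ^ 2 * Polynomial.C K : Polynomial ℂ) ≠ 0 := by
    intro h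
    have := congrArg (Polynomial.eval 0) h
    simp at this
    exact hc this
  refine (Polynomial.finite_setOfPred_isRoot hp).subset ?_
  intro z hz
  have hz2 : c + z ^ 2 * K = 0 := hz
  rw [mul_comm] at hz2
  simpa [Polynomial.IsRoot] using hz2

/-- Case 4 of Lemma 1: if `(Δ¹, Δ³) ≠ (0,0)` and `(Δ⁵, Δ⁶) ≠ (0,0)`, then the
first three columns of `X'(θ; Δ)` are singular for only finitely many
`θ ∈ [0, 2π]`, and consequently `X'(θ; Δ)` has rank 3 for all but finitely
many `θ ∈ [0, 2π]`. -/
theorem case4_finite_singular (Δ : Fin 6 → ℂ)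
    (h13 : ¬(Δ 0 = 0 ∧ Δ 2 = 0)) (h56 : ¬(Δ 4 = 0 ∧ Δ 5 = 0))
    (hcpd : ∀ k, Δ k = 0 ∨ ((Δ k).re ≠ 0 ∧ (Δ k).im ≠ 0)) :
    {θ ∈ Set.Icc (0 : ℝ) (2 * Real.pi) |
      ((Xc θ Δ).submatrix id (Fin.castSucc)).det = 0}.Finite ∧
    {θ ∈ Set.Icc (0 : ℝ) (2 * Real.pi) | (Xc θ Δ).rank ≠ 3}.Finite := by
  have hb : (((Δ 0).re : ℂ) ^ 2 + ((Δ 1).re : ℂ) ^ 2 + ((Δ 2).im : ℂ) ^ 2 + ((Δ 3).im : ℂ) ^ 2) *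
      (((Δ 2).re : ℂ) + ((Δ 0).im : ℂ) * I) ≠ 0 := by
    apply mul_ne_zero
    · have : 0 < (Δ 0).re ^ 2 + (Δ 1).re ^ 2 + (Δ 2).im ^ 2 + (Δ 3).im ^ 2 := by
        by_cases h : Δ 0 = 0
        · have h2 : Δ 2 ≠ 0 := fun h' => h13 ⟨h, h'⟩
          have := ((hcpd 2).resolve_left h2).2
          positivity
        · have := ((hcpd 0).resolve_left h).1
          positivity
      exact_mod_cast this.ne'
    · intro h
      have hr := congrArg Complex.re h
      have hi := congrArg Complex.im h
      simp at hr hi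
      apply h13
      constructor
      · exact (hcpd 0).resolve_right fun h' => h'.2 hi
      · exact (hcpd 2).resolve_right fun h' => h'.1 hr
  have h1 : {θ ∈ Set.Icc (0 : ℝ) (2 * Real.pi) |
      ((Xc θ Δ).submatrix id (Fin.castSucc)).det = 0}.Finite := by
    refine (finite_angles _ (finite_roots _
      ((((Δ 4).re : ℂ) + ((Δ 5).im : ℂ) * I) *
        ((((Δ 1).re : ℂ) + ((Δ 3).im : ℂ) * I) * (-((Δ 5).re : ℂ) + ((Δ 4).im : ℂ) * I) -
         (((Δ 0).re : ℂ) - ((Δ 2).im : ℂ) * I) * (((Δ 5).re : ℂ) + ((Δ 4).im : ℂ) * I)) -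
       (((Δ 3).re : ℂ) + ((Δ 1).im : ℂ) * I) *
        ((((Δ 0).re : ℂ) + ((Δ 2).im : ℂ) * I) * (-((Δ 5).re : ℂ) + ((Δ 4).im : ℂ) * I) -
         (-((Δ 1).re : ℂ) + ((Δ 3).im : ℂ) * I) * (((Δ 5).re : ℂ) + ((Δ 4).im : ℂ) * I)))
      hb)).subset ?_
    rintro θ ⟨hθ, hd⟩
    refine ⟨hθ, ?_⟩
    rw [Matrix.det_fin_three] at hd
    have e0 : Fin.castSucc (0 : Fin 3) = (0 : Fin 4) := rfl
    have e1 : Fin.castSucc (1 : Fin 3) = (1 : Fin 4) := rfl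
    have e2 : Fin.castSucc (2 : Fin 3) = (2 : Fin 4) := rfl
    simp only [Matrix.submatrix_apply, id, e0, e1, e2] at hd
    simp only [Xc, Matrix.cons_val] at hd
    show _ = _
    rw [← hd]
    generalize exp (θ * I) = z
    have hI : I ^ 2 = -1 := Complex.I_sq
    linear_combination ((((Δ 2).im : ℂ) ^ 2 + ((Δ 3).im : ℂ) ^ 2) *
      (((Δ 2).re : ℂ) + ((Δ 0).im : ℂ) * I)) * hI
  refine ⟨h1, h1.subset ?_⟩
  rintro θ ⟨hθ, hr⟩
  refine ⟨hθ, ?_⟩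
  by_contra hd
  apply hr
  apply le_antisymm
  · simpa using (Xc θ Δ).rank_le_height
  · have hrank : ((Xc θ Δ).submatrix id (Fin.castSucc)).rank = 3 := by
      have := Matrix.rank_of_isUnit _ ((Matrix.isUnit_iff_isUnit_det _).2 (isUnit_iff_ne_zero.2 hd))
      simpa using this
    have hm : (Xc θ Δ).submatrix id (Fin.castSucc) =
        Xc θ Δ * (1 : Matrix (Fin 4) (Fin 4) ℂ).submatrix id (Fin.castSucc) := by
      ext i j
      simp [Matrix.mul_apply, Matrix.one_apply]
    refine hrank.symm.le.trans ?_
    rw [hm]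
    exact Matrix.rank_mul_le_left _ _
end

section
/- For every θ ∈ ℝ, taking H = [[1,0,0],[0,1,1],[1,0,1]] and G = [[0,0,0],[1,0,0],[1,−e^{2iθ},1]], the 6×6 matrix R(H,G,θ) has determinant −2; in particular, for every θ ∈ ℝ there exist 3×3 complex matrices H, G such that R(H,G,θ) is invertible. -/
open Complex Matrix

/-- The effective 6×6 transfer matrix `R(H,G,θ)` of the desired symbols
`p¹,p²,p³` at receiver 1 in the proposed scheme for the (2,2,3) X-network. -/
noncomputable def Rmat (H G : Matrix (Fin 3) (Fin 3) ℂ) (θ : ℝ) : Matrix (Fin 6) (Fin 6) ℂ :=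
  ![![H 0 0, H 0 1, exp (θ * I) * H 0 2, G 0 0, G 0 1, exp (θ * I) * G 0 2],
    ![(starRingEnd ℂ) (H 0 1), -(starRingEnd ℂ) (H 0 0), -exp (-θ * I) * (starRingEnd ℂ) (H 0 2),
      (starRingEnd ℂ) (G 0 1), -(starRingEnd ℂ) (G 0 0), -exp (-θ * I) * (starRingEnd ℂ) (G 0 2)],
    ![H 1 0, H 1 1, exp (θ * I) * H 1 2, G 1 0, G 1 1, exp (θ * I) * G 1 2],
    ![(starRingEnd ℂ) (H 1 1), -(starRingEnd ℂ) (H 1 0), -exp (-θ * I) * (starRingEnd ℂ) (H 1 2),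
      (starRingEnd ℂ) (G 1 1), -(starRingEnd ℂ) (G 1 0), -exp (-θ * I) * (starRingEnd ℂ) (G 1 2)],
    ![H 2 0, H 2 1, exp (θ * I) * H 2 2, G 2 0, G 2 1, exp (θ * I) * G 2 2],
    ![(starRingEnd ℂ) (H 2 1), -(starRingEnd ℂ) (H 2 0), -exp (-θ * I) * (starRingEnd ℂ) (H 2 2),
      (starRingEnd ℂ) (G 2 1), -(starRingEnd ℂ) (G 2 0), -exp (-θ * I) * (starRingEnd ℂ) (G 2 2)]]

/-- The effective 6×6 transfer matrix `S(H,G,θ)` of the remaining desired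
symbols `p⁴,p⁵,p⁶` at receiver 1 in the proposed scheme. -/
noncomputable def Smat (H G : Matrix (Fin 3) (Fin 3) ℂ) (θ : ℝ) : Matrix (Fin 6) (Fin 6) ℂ :=
  ![![H 0 0, exp (-θ * I) * H 0 2, H 0 1, G 0 0, exp (-θ * I) * G 0 2, G 0 1],
    ![(starRingEnd ℂ) (H 0 1), -(starRingEnd ℂ) (H 0 0), -exp (-θ * I) * (starRingEnd ℂ) (H 0 2),
      (starRingEnd ℂ) (G 0 1), -(starRingEnd ℂ) (G 0 0), -exp (-θ * I) * (starRingEnd ℂ) (G 0 2)],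
    ![H 1 0, exp (-θ * I) * H 1 2, H 1 1, G 1 0, exp (-θ * I) * G 1 2, G 1 1],
    ![(starRingEnd ℂ) (H 1 1), -(starRingEnd ℂ) (H 1 0), -exp (-θ * I) * (starRingEnd ℂ) (H 1 2),
      (starRingEnd ℂ) (G 1 1), -(starRingEnd ℂ) (G 1 0), -exp (-θ * I) * (starRingEnd ℂ) (G 1 2)],
    ![H 2 0, exp (-θ * I) * H 2 2, H 2 1, G 2 0, exp (-θ * I) * G 2 2, G 2 1],
    ![(starRingEnd ℂ) (H 2 1), -(starRingEnd ℂ) (H 2 0), -exp (-θ * I) * (starRingEnd ℂ) (H 2 2),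
      (starRingEnd ℂ) (G 2 1), -(starRingEnd ℂ) (G 2 0), -exp (-θ * I) * (starRingEnd ℂ) (G 2 2)]]

/-- For every `θ`, the specific assignment of `H` and `G` from the proof of
Theorem 2 makes `det R(H,G,θ) = -2`; in particular `R` can be made invertible. -/
theorem det_R_specific (θ : ℝ) :
    (Rmat !![1, 0, 0; 0, 1, 1; 1, 0, 1]
          !![0, 0, 0; 1, 0, 0; 1, -exp (2 * θ * I), 1] θ).det = -2 ∧
    ∃ H G : Matrix (Fin 3) (Fin 3) ℂ, IsUnit (Rmat H G θ) := by
  have hdet : (Rmat !![1, 0, 0; 0, 1, 1; 1, 0, 1]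
          !![0, 0, 0; 1, 0, 0; 1, -exp (2 * θ * I), 1] θ).det = -2 := by
    have hc : (starRingEnd ℂ) (exp (2 * θ * I)) = exp (-θ * I) ^ 2 := by
      rw [← Complex.exp_conj, ← Complex.exp_nat_mul]
      congr 1
      have h22 : (starRingEnd ℂ) (2 : ℂ) = 2 := Complex.conj_ofNat 2
      simp [h22]
      ring
    have h2 : exp (2 * θ * I) = exp (θ * I) ^ 2 := by
      rw [← Complex.exp_nat_mul]
      congr 1
      push_cast
      ring
    have hef : exp (θ * I) * exp (-θ * I) = 1 := by
      rw [← Complex.exp_add]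
      simp
    have hM : Rmat !![1, 0, 0; 0, 1, 1; 1, 0, 1]
          !![0, 0, 0; 1, 0, 0; 1, -exp (2 * θ * I), 1] θ =
        !![1, 0, 0, 0, 0, 0;
           0, -1, 0, 0, 0, 0;
           0, 1, exp (θ * I), 1, 0, 0;
           1, 0, -exp (-θ * I), 0, -1, 0;
           1, 0, exp (θ * I), 1, -exp (θ * I) ^ 2, exp (θ * I);
           0, -1, -exp (-θ * I), -exp (-θ * I) ^ 2, -1, -exp (-θ * I)] := by
      ext i j
      fin_cases i <;> fin_cases j <;> simp [Rmat, -neg_mul, hc] <;> simp [h2]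
    rw [hM]
    generalize exp (θ * I) = e at hef
    generalize exp (-θ * I) = f at hef
    simp [Matrix.det_succ_row_zero, Fin.sum_univ_succ, Fin.succAbove]
    linear_combination (-2 * (e * f) - 2) * hef
  refine ⟨hdet, !![1, 0, 0; 0, 1, 1; 1, 0, 1],
    !![0, 0, 0; 1, 0, 0; 1, -exp (2 * θ * I), 1], (Matrix.isUnit_iff_isUnit_det _).2 ?_⟩
  rw [hdet]
  norm_num
end

section
/- For every θ ∈ ℝ, the function (H, G) ↦ det R(H,G,θ), viewed as a polynomial in the real and imaginary parts of the entries of the 3×3 complex matrices H and G, is not identically zero, and likewise (H, G) ↦ det S(H,G,θ) is not identically zero; equivalently, for every θ ∈ ℝ the set of pairs (H, G) for which R(H,G,θ) or S(H,G,θ) is singular is a proper algebraic subset of the space of pairs of 3×3 complex matrices. -/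
open Complex Matrix

/-- Witness for `H`. -/
def wH : Matrix (Fin 3) (Fin 3) ℂ := !![1, 0, 0; 0, 0, 0; 0, 1, 1]

/-- Witness for `G`. -/
noncomputable def wG : Matrix (Fin 3) (Fin 3) ℂ := !![0, 0, 0; 1, 0, 0; 0, 0, I]

lemma wR (θ : ℝ) : (Rmat wH wG θ).det ≠ 0 := by
  intro h
  obtain ⟨v, hv, h⟩ := Matrix.exists_mulVec_eq_zero_iff.mpr h
  have hu := Complex.exp_ne_zero (θ * I)
  have hw := Complex.exp_ne_zero (-θ * I)
  apply hv
  unfold Rmat at h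
  generalize exp (θ * I) = u at *
  generalize exp (-θ * I) = w at *
  have e0 := congrFun h 0
  have e1 := congrFun h 1
  have e2 := congrFun h 2
  have e3 := congrFun h 3
  have e4 := congrFun h 4
  have e5 := congrFun h 5
  clear h
  simp [wH, wG, Matrix.mulVec, dotProduct, Fin.sum_univ_six] at e0 e1 e2 e3 e4 e5
  simp only [e0, e1] at e4 e5
  have a : v 2 + I * v 5 = 0 := mul_left_cancel₀ hu (by linear_combination e4)
  have b : -v 2 + I * v 5 = 0 := mul_left_cancel₀ hw (by linear_combination e5)
  have h2 : v 2 = 0 := by linear_combination (a - b) / 2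
  have h5 : v 5 = 0 := mul_left_cancel₀ I_ne_zero (by linear_combination (a + b) / 2)
  funext i
  fin_cases i <;> assumption

lemma wS (θ : ℝ) : (Smat wH wG θ).det ≠ 0 := by
  intro h
  obtain ⟨v, hv, h⟩ := Matrix.exists_mulVec_eq_zero_iff.mpr h
  have hu := Complex.exp_ne_zero (θ * I)
  have hw := Complex.exp_ne_zero (-θ * I)
  apply hv
  unfold Smat at h
  generalize exp (θ * I) = u at *
  generalize exp (-θ * I) = w at *
  have e0 := congrFun h 0
  have e1 := congrFun h 1
  have e2 := congrFun h 2
  have e3 := congrFun h 3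
  have e4 := congrFun h 4
  have e5 := congrFun h 5
  clear h
  simp [wH, wG, Matrix.mulVec, dotProduct, Fin.sum_univ_six] at e0 e1 e2 e3 e4 e5
  simp only [e1, e3] at e4
  have h2 : v 2 = 0 := by linear_combination e4
  simp only [e0, h2] at e5
  have h5 : v 5 = 0 :=
    mul_left_cancel₀ (mul_ne_zero hw I_ne_zero) (by linear_combination e5)
  funext i
  fin_cases i <;> assumption

/-- For every `θ`, the determinants of `R(H,G,θ)` and `S(H,G,θ)` are not
identically zero as functions of `(H, G)`; equivalently, the set of pairs
`(H, G)` for which `R(H,G,θ)` or `S(H,G,θ)` is singular is a proper subset of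
the space of pairs of 3×3 complex matrices. -/
theorem det_R_det_S_not_identically_zero (θ : ℝ) :
    (∃ H G : Matrix (Fin 3) (Fin 3) ℂ, (Rmat H G θ).det ≠ 0) ∧
    (∃ H G : Matrix (Fin 3) (Fin 3) ℂ, (Smat H G θ).det ≠ 0) ∧
    {p : Matrix (Fin 3) (Fin 3) ℂ × Matrix (Fin 3) (Fin 3) ℂ |
      (Rmat p.1 p.2 θ).det = 0 ∨ (Smat p.1 p.2 θ).det = 0} ≠ Set.univ := by
  refine ⟨⟨wH, wG, wR θ⟩, ⟨wH, wG, wS θ⟩, fun h => ?_⟩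
  have h2 : (wH, wG) ∈ {p : Matrix (Fin 3) (Fin 3) ℂ × Matrix (Fin 3) (Fin 3) ℂ |
      (Rmat p.1 p.2 θ).det = 0 ∨ (Smat p.1 p.2 θ).det = 0} := by rw [h]; trivial
  exact h2.elim (wR θ) (wS θ)
end
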